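/- arXiv:1604.01983 — 2 statements merged into one kernel-verified Lean document; each statement's English description precedes it below -/
import Mathlib

section
/- Let f2(x; λ, κ) be the Weibull density with parameters λ, κ > 0 and f1(x; μ, τ) the lognormal density with parameters μ ∈ ℝ, τ > 0. Then D_KL(f2(·; λ, κ) ‖ f1(·; μ, τ)) = log κ − γ − 1 − (1/2) log(τ/(2π)) + (τ/2)(π²/(6κ²) + (log λ − γ/κ − μ)²), where γ is the Euler–Mascheroni constant. -/
open MeasureTheory Real

/-- Kullback--Leibler divergence between two densities on `(0, ∞)` (i.e. `∫₀^∞`). -/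
noncomputable def klDivPos (f g : ℝ → ℝ) : ℝ :=
  ∫ x in Set.Ioi (0:ℝ), f x * Real.log (f x / g x)

/-- Lognormal density with log-scale `μ` and precision-type parameter `τ`. -/
noncomputable def lognormalPdf (μ τ : ℝ) (x : ℝ) : ℝ :=
  (1 / x) * Real.sqrt (τ / (2 * Real.pi)) * Real.exp (-(τ * (Real.log x - μ) ^ 2) / 2)

/-- Weibull density with scale `λ` and shape `κ` (real powers). -/
noncomputable def weibullPdf (lam κ : ℝ) (x : ℝ) : ℝ :=
  (κ / lam) * (x / lam) ^ (κ - 1) * Real.exp (-((x / lam) ^ κ))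

/-- The complex function `(log t)^n * exp(-t)`. -/
noncomputable def klF (n : ℕ) (t : ℝ) : ℂ := (((Real.log t) ^ n * Real.exp (-t) : ℝ) : ℂ)

lemma klF_succ (n : ℕ) : (fun t => Real.log t • klF n t) = klF (n + 1) := by
  funext t
  simp [klF, pow_succ]
  ring

lemma klF_top (n : ℕ) : ∀ a : ℝ, klF n =O[Filter.atTop] (fun t : ℝ => t ^ (-a)) := by
  induction n with
  | zero =>
    intro a
    rw [← Asymptotics.isBigO_norm_left]
    simp_rw [klF, Complex.norm_real, Asymptotics.isBigO_norm_left]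
    simpa only [neg_one_mul, pow_zero, one_mul] using
      (isLittleO_exp_neg_mul_rpow_atTop zero_lt_one (-a)).isBigO
  | succ n ih =>
    intro a
    rw [← klF_succ]
    exact isBigO_rpow_top_log_smul (lt_add_one a) (ih _)

lemma klF_bot (n : ℕ) : ∀ b : ℝ, 0 < b →
    klF n =O[nhdsWithin 0 (Set.Ioi 0)] (fun t : ℝ => t ^ (-b)) := by
  have h0 : klF 0 =O[nhdsWithin 0 (Set.Ioi 0)] (fun t : ℝ => t ^ (-(0:ℝ))) := by
    simp_rw [neg_zero, Real.rpow_zero]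
    refine Asymptotics.isBigO_const_of_tendsto
      (?_ : Filter.Tendsto _ _ (nhds (1 : ℂ))) one_ne_zero
    have : ContinuousWithinAt (fun t : ℝ => ((Real.exp (-t) : ℝ) : ℂ)) (Set.Ioi 0) 0 :=
      (Complex.continuous_ofReal.comp
        (Real.continuous_exp.comp continuous_neg)).continuousWithinAt
    have h := this.tendsto
    simp only [neg_zero, Real.exp_zero, Complex.ofReal_one] at h
    refine h.congr fun t => ?_
    simp [klF]
  have key : ∀ n : ℕ, ∀ b : ℝ, 0 < b →
      klF (n + 1) =O[nhdsWithin 0 (Set.Ioi 0)] (fun t : ℝ => t ^ (-b)) := by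
    intro n
    induction n with
    | zero =>
      intro b hb
      rw [← klF_succ]
      exact isBigO_rpow_zero_log_smul hb h0
    | succ n ih =>
      intro b hb
      rw [← klF_succ]
      exact isBigO_rpow_zero_log_smul (half_lt_self hb) (ih _ (half_pos hb))
  intro b hb
  cases n with
  | succ n => exact key n b hb
  | zero =>
    refine h0.trans ?_
    refine Asymptotics.IsBigO.of_bound 1 ?_
    have : ∀ᶠ t : ℝ in nhdsWithin 0 (Set.Ioi 0), t ∈ Set.Ioo (0:ℝ) 1 :=
      Ioo_mem_nhdsGT one_pos
    filter_upwards [this] with t ht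
    simp only [neg_zero, Real.rpow_zero, norm_one, one_mul]
    rw [Real.norm_of_nonneg (Real.rpow_nonneg ht.1.le _)]
    exact Real.one_le_rpow_of_pos_of_le_one_of_nonpos ht.1 ht.2.le (by linarith)

lemma klF_deriv (n : ℕ) {s : ℂ} (hs : 0 < s.re) :
    MellinConvergent (klF (n + 1)) s ∧
      HasDerivAt (mellin (klF n)) (mellin (klF (n + 1)) s) s := by
  have hc : LocallyIntegrableOn (klF n) (Set.Ioi 0) := by
    refine ContinuousOn.locallyIntegrableOn ?_ measurableSet_Ioi
    unfold klF
    refine Complex.continuous_ofReal.comp_continuousOn ?_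
    refine ContinuousOn.mul (ContinuousOn.pow ?_ n) (by fun_prop)
    exact Real.continuousOn_log.mono fun x hx => (ne_of_gt hx : x ≠ 0)
  have := mellin_hasDerivAt_of_isBigO_rpow (E := ℂ) hc (klF_top n (s.re + 1)) (lt_add_one _)
    (klF_bot n (s.re / 2) (by linarith)) (by linarith)
  rwa [klF_succ] at this

lemma klF_zero {s : ℂ} (hs : 0 < s.re) : mellin (klF 0) s = Complex.Gamma s := by
  rw [Complex.Gamma_eq_integral hs, Complex.GammaIntegral_eq_mellin]
  congr 1
  funext t
  simp [klF]

lemma klF_mellin_one (n : ℕ) :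
    mellin (klF n) 1 = ((∫ t in Set.Ioi (0:ℝ), Real.log t ^ n * Real.exp (-t) : ℝ) : ℂ) := by
  rw [mellin, ← integral_complex_ofReal]
  simp [klF]

lemma kl_int (n : ℕ) :
    IntegrableOn (fun t : ℝ => Real.log t ^ (n + 1) * Real.exp (-t)) (Set.Ioi 0) := by
  have h := (klF_deriv n (s := 1) (by simp)).1
  rw [MellinConvergent] at h
  have h2 := h.re
  refine h2.congr (Filter.Eventually.of_forall fun t => ?_)
  simp [klF, -Complex.ofReal_mul, -Complex.ofReal_pow]

lemma kl_refl {z : ℂ} (hz : z ∈ Metric.ball (0:ℂ) 1) :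
    mellin (klF 0) (1 + z) * mellin (klF 0) (1 - z) * Complex.sin (π * z) = π * z := by
  have hz' : |z.re| < 1 := lt_of_le_of_lt (Complex.abs_re_le_norm z) (by simpa using hz)
  rw [abs_lt] at hz'
  rw [klF_zero (by simp; linarith), klF_zero (by simp; linarith)]
  by_cases h0 : z = 0
  · simp [h0]
  have hs : Complex.sin (π * z) ≠ 0 := by
    intro h
    rw [Complex.sin_eq_zero_iff] at h
    obtain ⟨k, hk⟩ := h
    have hpi : (π : ℂ) ≠ 0 := Complex.ofReal_ne_zero.mpr Real.pi_ne_zero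
    have hzk : z = k := by
      apply mul_left_cancel₀ hpi
      rw [hk]; ring
    rw [hzk] at hz' h0
    simp only [Complex.intCast_re] at hz'
    have h1 : (-1 : ℤ) < k := by exact_mod_cast hz'.1
    have h2 : k < (1 : ℤ) := by exact_mod_cast hz'.2
    have : k = 0 := by omega
    simp [this] at h0
  have := Complex.Gamma_mul_Gamma_one_sub z
  rw [add_comm, Complex.Gamma_add_one _ h0, mul_assoc z, this, mul_assoc, div_mul_cancel₀ _ hs,
    mul_comm]

lemma kl_second : mellin (klF 2) 1 = (π : ℂ) ^ 2 / 6 + (mellin (klF 1) 1) ^ 2 := by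
  have hre : ∀ z ∈ Metric.ball (0:ℂ) 1, 0 < (1 + z).re ∧ 0 < (1 - z).re := by
    intro z hz
    have hz' : |z.re| < 1 := lt_of_le_of_lt (Complex.abs_re_le_norm z) (by simpa using hz)
    rw [abs_lt] at hz'
    constructor <;> simp <;> linarith
  have hp : ∀ n, ∀ z ∈ Metric.ball (0:ℂ) 1,
      HasDerivAt (fun z => mellin (klF n) (1 + z)) (mellin (klF (n + 1)) (1 + z)) z := by
    intro n z hz
    exact (klF_deriv n (hre z hz).1).2.comp_const_add 1 z
  have hm : ∀ n, ∀ z ∈ Metric.ball (0:ℂ) 1,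
      HasDerivAt (fun z => mellin (klF n) (1 - z)) (-mellin (klF (n + 1)) (1 - z)) z := by
    intro n z hz
    exact (klF_deriv n (hre z hz).2).2.comp_const_sub 1 z
  have hsin : ∀ z : ℂ, HasDerivAt (fun z : ℂ => Complex.sin (π * z))
      (Complex.cos (π * z) * π) z := by
    intro z
    simpa using ((hasDerivAt_id z).const_mul (π : ℂ)).csin
  have hcos : ∀ z : ℂ, HasDerivAt (fun z : ℂ => Complex.cos (π * z))
      (-Complex.sin (π * z) * π) z := by
    intro z
    simpa using ((hasDerivAt_id z).const_mul (π : ℂ)).ccos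
  have uniq : ∀ {f g : ℂ → ℂ} {f' g' z : ℂ}, z ∈ Metric.ball (0:ℂ) 1 →
      (∀ w ∈ Metric.ball (0:ℂ) 1, f w = g w) → HasDerivAt f f' z → HasDerivAt g g' z →
      f' = g' := by
    intro f g f' g' z hz h hf hg
    refine hf.unique (hg.congr_of_eventuallyEq ?_)
    filter_upwards [Metric.isOpen_ball.mem_nhds hz] with w hw using h w hw
  set M := fun n => mellin (klF n) with hM
  have e1 := fun z (hz : z ∈ Metric.ball (0:ℂ) 1) =>
    uniq hz (fun w hw => kl_refl hw) (((hp 0 z hz).mul (hm 0 z hz)).mul (hsin z))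
      ((hasDerivAt_id z).const_mul (π : ℂ))
  have e2 := fun z (hz : z ∈ Metric.ball (0:ℂ) 1) =>
    uniq hz e1
      (((((hp 1 z hz).mul (hm 0 z hz)).add ((hp 0 z hz).mul (hm 1 z hz).neg)).mul (hsin z)).add
        (((hp 0 z hz).mul (hm 0 z hz)).mul ((hcos z).mul_const (π : ℂ))))
      (hasDerivAt_const z _)
  have h00 : (0:ℂ) ∈ Metric.ball (0:ℂ) 1 := by simp
  have e2' : ∀ z ∈ Metric.ball (0:ℂ) 1,
      (M 2 (1 + z) * M 0 (1 - z) - 2 * (M 1 (1 + z) * M 1 (1 - z)) + M 0 (1 + z) * M 2 (1 - z))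
          * Complex.sin (π * z)
        + (2 * π) * ((M 1 (1 + z) * M 0 (1 - z) - M 0 (1 + z) * M 1 (1 - z))
          * Complex.cos (π * z))
        - (π : ℂ) ^ 2 * (M 0 (1 + z) * M 0 (1 - z) * Complex.sin (π * z)) = 0 := by
    intro z hz
    rw [← e2 z hz]
    simp only [hM, Pi.mul_apply, Pi.neg_apply, Pi.add_apply]
    ring
  have e3 := uniq h00 e2'
    ((((((hp 2 0 h00).mul (hm 0 0 h00)).sub (((hp 1 0 h00).mul (hm 1 0 h00)).const_mul 2)).add
        ((hp 0 0 h00).mul (hm 2 0 h00))).mul (hsin 0)).add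
      (((((hp 1 0 h00).mul (hm 0 0 h00)).sub ((hp 0 0 h00).mul (hm 1 0 h00))).mul
        (hcos 0)).const_mul (2 * (π : ℂ))) |>.sub
      ((((hp 0 0 h00).mul (hm 0 0 h00)).mul (hsin 0)).const_mul ((π : ℂ) ^ 2)))
    (hasDerivAt_const 0 _)
  have hM0 : mellin (klF 0) 1 = 1 := by rw [klF_zero (by simp), Complex.Gamma_one]
  simp [hM0] at e3
  have hpi : (π : ℂ) ≠ 0 := Complex.ofReal_ne_zero.mpr Real.pi_ne_zero
  apply mul_left_cancel₀ hpi
  linear_combination e3 / 6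

lemma kl_first : mellin (klF 1) 1 = -(Real.eulerMascheroniConstant : ℂ) := by
  have h := (klF_deriv 0 (s := 1) (by simp)).2
  refine h.unique (Complex.hasDerivAt_Gamma_one.congr_of_eventuallyEq ?_)
  have : ∀ᶠ s : ℂ in nhds 1, 0 < s.re :=
    (isOpen_lt continuous_const Complex.continuous_re).mem_nhds (by simp)
  filter_upwards [this] with s hs using klF_zero hs

lemma kl_log1 : ∫ t in Set.Ioi (0:ℝ), Real.log t ^ 1 * Real.exp (-t) =
    -Real.eulerMascheroniConstant := by
  have := kl_first
  rw [klF_mellin_one] at this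
  exact_mod_cast this

lemma kl_log2 : ∫ t in Set.Ioi (0:ℝ), Real.log t ^ 2 * Real.exp (-t) =
    π ^ 2 / 6 + Real.eulerMascheroniConstant ^ 2 := by
  have := kl_second
  rw [kl_first, klF_mellin_one, neg_sq] at this
  exact_mod_cast this

lemma kl_one : IntegrableOn (fun t : ℝ => t * Real.exp (-t)) (Set.Ioi 0) ∧
    ∫ t in Set.Ioi (0:ℝ), t * Real.exp (-t) = 1 := by
  have h1 := Real.GammaIntegral_convergent (s := 2) (by norm_num)
  have h2 := Real.Gamma_eq_integral (s := 2) (by norm_num)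
  rw [Real.Gamma_two] at h2
  have e : ∀ x : ℝ, Real.exp (-x) * x ^ ((2:ℝ) - 1) = x * Real.exp (-x) := by
    intro x
    norm_num [mul_comm]
  simp_rw [e] at h1 h2
  exact ⟨h1, h2.symm⟩

/-- The transformed integrand. -/
lemma kl_G (A B C : ℝ) :
    ∫ t in Set.Ioi (0:ℝ), Real.exp (-t) * (A + B * Real.log t - t + C * Real.log t ^ 2) =
      A - B * Real.eulerMascheroniConstant - 1 +
        C * (π ^ 2 / 6 + Real.eulerMascheroniConstant ^ 2) := by
  have i0 : IntegrableOn (fun t : ℝ => A * Real.exp (-t)) (Set.Ioi 0) :=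
    (integrableOn_exp_neg_Ioi 0).const_mul A
  have i1 := (kl_int 0).const_mul B
  have i2 := (kl_int 1).const_mul C
  obtain ⟨i3, v3⟩ := kl_one
  have : ∀ t : ℝ, Real.exp (-t) * (A + B * Real.log t - t + C * Real.log t ^ 2) =
      A * Real.exp (-t) + B * (Real.log t ^ (0 + 1) * Real.exp (-t)) - t * Real.exp (-t)
        + C * (Real.log t ^ (1 + 1) * Real.exp (-t)) := by
    intro t; ring
  simp_rw [this]
  have i01 : Integrable (fun t : ℝ => A * Real.exp (-t)
      + B * (Real.log t ^ (0 + 1) * Real.exp (-t))) (volume.restrict (Set.Ioi 0)) := i0.add i1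
  have i013 : Integrable (fun t : ℝ => A * Real.exp (-t)
      + B * (Real.log t ^ (0 + 1) * Real.exp (-t)) - t * Real.exp (-t))
      (volume.restrict (Set.Ioi 0)) := i01.sub i3
  rw [integral_add i013 i2, integral_sub i01 i3, integral_add i0 i1,
    integral_const_mul, integral_const_mul, integral_const_mul, v3, zero_add, kl_log1,
    one_add_one_eq_two, kl_log2, integral_exp_neg_Ioi_zero]
  ring

/-- the Kullback--Leibler divergence from the Weibull(λ, κ) density to the
lognormal(μ, τ) density is
`log κ − γ − 1 − (1/2) log(τ/(2π)) + (τ/2)(π²/(6κ²) + (log λ − γ/κ − μ)²)`,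
with `γ` the Euler--Mascheroni constant. -/
theorem kl_weibull_lognormal (lam κ μ τ : ℝ) (hlam : 0 < lam) (hκ : 0 < κ) (hτ : 0 < τ) :
    klDivPos (weibullPdf lam κ) (lognormalPdf μ τ) =
      Real.log κ - Real.eulerMascheroniConstant - 1 -
        (1 / 2) * Real.log (τ / (2 * Real.pi)) +
        (τ / 2) * (Real.pi ^ 2 / (6 * κ ^ 2) +
          (Real.log lam - Real.eulerMascheroniConstant / κ - μ) ^ 2) := by
  set c := Real.log lam - μ with hc
  set L := Real.log (τ / (2 * π)) with hL
  let G : ℝ → ℝ := fun t => Real.exp (-t) *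
    ((Real.log κ - 1 / 2 * L + τ / 2 * c ^ 2) + (1 + τ * c / κ) * Real.log t - t
      + (τ / (2 * κ ^ 2)) * Real.log t ^ 2)
  let H : ℝ → ℝ := fun y => (κ * y ^ (κ - 1)) • G (y ^ κ)
  have hτ' : 0 < τ / (2 * π) := by positivity
  have key : ∀ x ∈ Set.Ioi (0:ℝ), weibullPdf lam κ x *
      Real.log (weibullPdf lam κ x / lognormalPdf μ τ x) = lam⁻¹ * H (lam⁻¹ * x) := by
    intro x hx
    have hx0 : 0 < x := hx
    have hy : 0 < x / lam := by positivity
    have hyx : lam⁻¹ * x = x / lam := by field_simp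
    have hlx : Real.log x = Real.log (x / lam) + Real.log lam := by
      rw [Real.log_div hx0.ne' hlam.ne']; ring
    have hw : 0 < weibullPdf lam κ x := by unfold weibullPdf; positivity
    have hl : 0 < lognormalPdf μ τ x := by
      unfold lognormalPdf
      have := Real.sqrt_pos.mpr hτ'
      positivity
    have lw : Real.log (weibullPdf lam κ x) = Real.log κ - Real.log lam
        + (κ - 1) * Real.log (x / lam) - (x / lam) ^ κ := by
      unfold weibullPdf
      rw [Real.log_mul (by positivity) (by positivity), Real.log_mul (by positivity)
        (by positivity), Real.log_exp, Real.log_rpow hy, Real.log_div hκ.ne' hlam.ne']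
      ring
    have ll : Real.log (lognormalPdf μ τ x) = -Real.log x + L / 2
        - τ * (Real.log x - μ) ^ 2 / 2 := by
      unfold lognormalPdf
      have hs := Real.sqrt_pos.mpr hτ'
      rw [Real.log_mul (by positivity) (by positivity), Real.log_mul (by positivity)
        hs.ne', Real.log_exp, Real.log_sqrt hτ'.le, one_div, Real.log_inv]
      ring
    rw [Real.log_div hw.ne' hl.ne', lw, ll, hyx]
    simp only [H, G, smul_eq_mul]
    rw [Real.log_rpow hy, hlx]
    unfold weibullPdf
    simp only [hc]
    field_simp
    ring
  unfold klDivPos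
  rw [setIntegral_congr_fun measurableSet_Ioi key, integral_const_mul,
    integral_comp_mul_left_Ioi H 0 (inv_pos.mpr hlam), mul_zero, smul_eq_mul, inv_inv,
    inv_mul_cancel_left₀ hlam.ne', integral_comp_rpow_Ioi_of_pos hκ]
  simp only [G]
  rw [kl_G]
  have : Real.log lam - Real.eulerMascheroniConstant / κ - μ
      = c - Real.eulerMascheroniConstant / κ := by rw [hc]; ring
  rw [this]
  field_simp
  ring
end

section
/- Let f2(x; λ, κ) be the Weibull density with parameters λ, κ > 0 and f1(x; μ, τ) the lognormal density with parameters μ ∈ ℝ, τ > 0. Then for every λ, κ > 0, the infimum over (μ, τ) ∈ ℝ × (0, ∞) of D_KL(f2(·; λ, κ) ‖ f1(·; μ, τ)) equals (1/2) log(2π) + log π − γ − (1/2) log 6 − 1/2, where γ is the Euler–Mascheroni constant; it is attained at μ = log λ − γ/κ and τ = 6κ²/π², and in particular the infimum does not depend on (λ, κ). -/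
open MeasureTheory Real

lemma aux_reflection :
    (fun s : ℂ => (Complex.Gamma (1 + s) * Complex.Gamma (1 - s)) * Complex.sin (π * s))
      =ᶠ[nhds 0] fun s : ℂ => (π : ℂ) * s := by
  filter_upwards [Metric.ball_mem_nhds (0:ℂ) one_pos] with s hs
  by_cases h0 : s = 0
  · simp [h0]
  have hsin : Complex.sin (π * s) ≠ 0 := by
    intro h
    obtain ⟨k, hk⟩ := Complex.sin_eq_zero_iff.1 h
    have hpi : (π : ℂ) ≠ 0 := by exact_mod_cast pi_ne_zero
    have hsk : s = k := by
      apply mul_left_cancel₀ hpi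
      rw [hk, mul_comm]
    rw [hsk] at hs h0
    simp only [Metric.mem_ball, dist_zero_right, Complex.norm_intCast] at hs
    have : k = 0 := by
      apply Int.abs_lt_one_iff.1
      exact_mod_cast hs
    exact h0 (by simp [this])
  rw [add_comm, Complex.Gamma_add_one s h0, mul_assoc, mul_assoc, ← mul_assoc (Complex.Gamma s),
    Complex.Gamma_mul_Gamma_one_sub, div_mul_cancel₀ _ hsin, mul_comm]

lemma aux_contDiffAt (n : ℕ) : ContDiffAt ℂ n Complex.Gamma 1 := by
  have ho : IsOpen {s : ℂ | 0 < s.re} := Complex.continuous_re.isOpen_preimage _ isOpen_Ioi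
  have : DifferentiableOn ℂ Complex.Gamma {s : ℂ | 0 < s.re} := by
    intro s hs
    refine (Complex.differentiableAt_Gamma s fun m h => ?_).differentiableWithinAt
    have h2 : s.re = -m := by rw [h]; simp
    have h3 : (0:ℝ) < s.re := hs
    have : (0:ℝ) ≤ m := m.cast_nonneg
    linarith
  exact (this.contDiffOn ho).contDiffAt (ho.mem_nhds (by simp))

lemma aux_Gamma_two : iteratedDeriv 2 Complex.Gamma 1
    = ((eulerMascheroniConstant ^ 2 + π ^ 2 / 6 : ℝ) : ℂ) := by
  have hd : deriv Complex.Gamma 1 = -(eulerMascheroniConstant : ℂ) :=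
    Complex.hasDerivAt_Gamma_one.deriv
  have hA (n : ℕ) : ContDiffAt ℂ n (fun s : ℂ => Complex.Gamma (1 + s)) 0 := by
    have h : ContDiffAt ℂ n Complex.Gamma (1 + 0) := by simpa using aux_contDiffAt n
    exact h.comp (0:ℂ) (by fun_prop)
  have hB (n : ℕ) : ContDiffAt ℂ n (fun s : ℂ => Complex.Gamma (1 - s)) 0 := by
    have h : ContDiffAt ℂ n Complex.Gamma (1 - 0) := by simpa using aux_contDiffAt n
    exact h.comp (0:ℂ) (by fun_prop)
  have hS (n : ℕ) : ContDiffAt ℂ n (fun s : ℂ => Complex.sin (π * s)) 0 := by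
    fun_prop
  have hG0 := iteratedDeriv_mul (hA 2) (hB 2)
  have hG := iteratedDeriv_mul ((hA 3).mul (hB 3)) (hS 3)
  have hE := (aux_reflection.iteratedDeriv_eq 3)
  have hE' : iteratedDeriv 3 (fun s : ℂ => (π : ℂ) * s) 0 = 0 := by
    simp [iteratedDeriv_succ]
  have hs (n : ℕ) : iteratedDeriv n (fun s : ℂ => Complex.sin (π * s)) =
      fun s => (π:ℂ)^n * iteratedDeriv n Complex.sin (π * s) :=
    iteratedDeriv_comp_const_mul Complex.contDiff_sin _
  have h1 : iteratedDeriv 1 Complex.sin 0 = 1 := by simp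
  have h2 : iteratedDeriv 2 Complex.sin 0 = 0 := by simp [iteratedDeriv_succ]
  have h3 : iteratedDeriv 3 Complex.sin 0 = -1 := by simp [iteratedDeriv_succ]
  have hG1 := hG.symm.trans (hE.trans hE')
  replace hG0 : iteratedDeriv 2 (fun s : ℂ => Complex.Gamma (1 + s) * Complex.Gamma (1 - s)) 0 = _ :=
    hG0
  simp only [Finset.sum_range_succ, Finset.sum_range_zero, hs, iteratedDeriv_comp_const_add,
    iteratedDeriv_comp_const_sub] at hG1 hG0
  norm_num [Nat.choose, hG0, h2, h3, hd] at hG1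
  have hpi : (π : ℂ) ≠ 0 := by exact_mod_cast pi_ne_zero
  push_cast
  apply mul_left_cancel₀ hpi
  linear_combination (1/6) * hG1


lemma aux_loc {f : ℝ → ℂ} (h : ContinuousOn f (Set.Ioi 0)) :
   LocallyIntegrableOn f (Set.Ioi 0) := h.locallyIntegrableOn measurableSet_Ioi

lemma aux_bigO_top (a : ℝ) : (fun x : ℝ => ((Real.exp (-x) : ℝ) : ℂ)) =O[Filter.atTop] (· ^ (-a)) := by
  rw [← Asymptotics.isBigO_norm_left]
  simp_rw [Complex.norm_real, Asymptotics.isBigO_norm_left]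
  simpa only [neg_one_mul] using (isLittleO_exp_neg_mul_rpow_atTop zero_lt_one _).isBigO

lemma aux_bigO_zero : (fun x : ℝ => ((Real.exp (-x) : ℝ) : ℂ)) =O[nhdsWithin 0 (Set.Ioi 0)]
    (· ^ (-(0:ℝ))) := by
  simp_rw [neg_zero, rpow_zero]
  refine Asymptotics.isBigO_const_of_tendsto (?_ : Filter.Tendsto _ _ (nhds (1 : ℂ))) one_ne_zero
  rw [(by simp : (1 : ℂ) = Real.exp (-0))]
  exact (Complex.continuous_ofReal.comp (Real.continuous_exp.comp continuous_neg)).continuousWithinAt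

lemma aux_first {s : ℂ} (hs : 0 < s.re) :
    MellinConvergent (fun t : ℝ => Real.log t • ((Real.exp (-t) : ℝ) : ℂ)) s ∧
    HasDerivAt Complex.Gamma (mellin (fun t : ℝ => Real.log t • ((Real.exp (-t) : ℝ) : ℂ)) s) s := by
  obtain ⟨h1, h2⟩ := mellin_hasDerivAt_of_isBigO_rpow (E := ℂ)
    (f := fun x : ℝ => ((Real.exp (-x) : ℝ) : ℂ)) (s := s)
    (aux_loc (by fun_prop)) (aux_bigO_top _) (lt_add_one _) aux_bigO_zero hs
  refine ⟨h1, ?_⟩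
  rw [← Complex.GammaIntegral_eq_mellin] at h2
  refine h2.congr_of_eventuallyEq ?_
  have ho : IsOpen {s : ℂ | 0 < s.re} := Complex.continuous_re.isOpen_preimage _ isOpen_Ioi
  filter_upwards [ho.mem_nhds hs] with a ha using Complex.Gamma_eq_integral ha

lemma aux_second :
    MellinConvergent (fun t : ℝ => Real.log t • (Real.log t • ((Real.exp (-t) : ℝ) : ℂ))) 1 ∧
    mellin (fun t : ℝ => Real.log t • (Real.log t • ((Real.exp (-t) : ℝ) : ℂ))) 1 =
      ((eulerMascheroniConstant ^ 2 + π ^ 2 / 6 : ℝ) : ℂ) := by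
  have hc : ContinuousOn (fun t : ℝ => Real.log t • ((Real.exp (-t) : ℝ) : ℂ)) (Set.Ioi 0) := by
    refine ContinuousOn.smul (continuousOn_log.mono ?_) (by fun_prop)
    intro x hx; exact ne_of_gt hx
  obtain ⟨h1, h2⟩ := mellin_hasDerivAt_of_isBigO_rpow (E := ℂ)
    (f := fun t : ℝ => Real.log t • ((Real.exp (-t) : ℝ) : ℂ)) (s := 1)
    (aux_loc hc) (isBigO_rpow_top_log_smul (a := 3) (b := 2) (by norm_num) (aux_bigO_top _))
    (by norm_num)
    (isBigO_rpow_zero_log_smul (b := 1/2) (by norm_num) aux_bigO_zero) (by norm_num)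
  refine ⟨h1, ?_⟩
  rw [← aux_Gamma_two, iteratedDeriv_succ, iteratedDeriv_one, ← h2.deriv]
  apply Filter.EventuallyEq.deriv_eq
  have ho : IsOpen {s : ℂ | 0 < s.re} := Complex.continuous_re.isOpen_preimage _ isOpen_Ioi
  filter_upwards [ho.mem_nhds (show (1:ℂ) ∈ {s : ℂ | 0 < s.re} by simp)] with a ha
    using (aux_first ha).2.deriv.symm

lemma int_log : IntegrableOn (fun t => Real.exp (-t) * Real.log t) (Set.Ioi 0) ∧
    ∫ t in Set.Ioi (0:ℝ), Real.exp (-t) * Real.log t = -eulerMascheroniConstant := by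
  obtain ⟨h1, h2⟩ := aux_first (s := 1) (by simp)
  have h3 := h2.unique Complex.hasDerivAt_Gamma_one
  have e : (fun t : ℝ => (t:ℂ) ^ ((1:ℂ) - 1) • (Real.log t • ((Real.exp (-t) : ℝ) : ℂ))) =
      fun t : ℝ => ((Real.exp (-t) * Real.log t : ℝ) : ℂ) := by
    ext t; simp [mul_comm]
  constructor
  · rw [MellinConvergent, e] at h1
    exact h1.re
  · rw [mellin, e, integral_complex_ofReal] at h3
    exact_mod_cast h3

lemma int_log_sq : IntegrableOn (fun t => Real.exp (-t) * Real.log t ^ 2) (Set.Ioi 0) ∧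
    ∫ t in Set.Ioi (0:ℝ), Real.exp (-t) * Real.log t ^ 2 =
      eulerMascheroniConstant ^ 2 + π ^ 2 / 6 := by
  obtain ⟨h1, h3⟩ := aux_second
  have e : (fun t : ℝ => (t:ℂ) ^ ((1:ℂ) - 1) • (Real.log t • (Real.log t • ((Real.exp (-t) : ℝ) : ℂ)))) =
      fun t : ℝ => ((Real.exp (-t) * Real.log t ^ 2: ℝ) : ℂ) := by
    ext t; simp; ring
  constructor
  · rw [MellinConvergent, e] at h1
    exact h1.re
  · rw [mellin, e, integral_complex_ofReal] at h3
    exact_mod_cast h3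

lemma int_exp : IntegrableOn (fun t => Real.exp (-t)) (Set.Ioi 0) ∧
    ∫ t in Set.Ioi (0:ℝ), Real.exp (-t) = 1 := by
  refine ⟨?_, integral_exp_neg_Ioi_zero⟩
  simpa using Real.GammaIntegral_convergent (s := 1) one_pos

lemma int_id : IntegrableOn (fun t => Real.exp (-t) * t) (Set.Ioi 0) ∧
    ∫ t in Set.Ioi (0:ℝ), Real.exp (-t) * t = 1 := by
  have h1 := Real.GammaIntegral_convergent (s := 2) two_pos
  have h2 := Real.Gamma_eq_integral (s := 2) two_pos
  norm_num at h1 h2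
  exact ⟨h1, h2.symm⟩

lemma int_quad (a b c : ℝ) :
    ∫ t in Set.Ioi (0:ℝ), Real.exp (-t) * (a + b * Real.log t + c * Real.log t ^ 2 - t) =
      a - b * eulerMascheroniConstant + c * (eulerMascheroniConstant ^ 2 + π ^ 2 / 6) - 1 := by
  have e : (fun t : ℝ => Real.exp (-t) * (a + b * Real.log t + c * Real.log t ^ 2 - t)) =
      fun t => a * Real.exp (-t) + b * (Real.exp (-t) * Real.log t) +
        c * (Real.exp (-t) * Real.log t ^ 2) - Real.exp (-t) * t := by
    ext t; ring
  have i1 := int_exp.1.const_mul a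
  have i2 := int_log.1.const_mul b
  have i3 := int_log_sq.1.const_mul c
  have i12 : Integrable (fun t => a * Real.exp (-t) + b * (Real.exp (-t) * Real.log t))
      (volume.restrict (Set.Ioi 0)) := i1.add i2
  have i123 : Integrable (fun t => a * Real.exp (-t) + b * (Real.exp (-t) * Real.log t) +
      c * (Real.exp (-t) * Real.log t ^ 2)) (volume.restrict (Set.Ioi 0)) := i12.add i3
  rw [e, integral_sub i123 int_id.1, integral_add i12 i3, integral_add i1 i2, integral_const_mul, integral_const_mul, integral_const_mul,
    int_exp.2, int_id.2, int_log.2, int_log_sq.2]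
  ring

lemma kl_formula (lam κ μ τ : ℝ) (hlam : 0 < lam) (hκ : 0 < κ) (hτ : 0 < τ) :
    klDivPos (weibullPdf lam κ) (lognormalPdf μ τ) =
      Real.log κ - eulerMascheroniConstant - 1 - 1 / 2 * Real.log (τ / (2 * π)) +
       τ / 2 * ((Real.log lam - μ - eulerMascheroniConstant / κ) ^ 2 + π ^ 2 / (6 * κ ^ 2)) := by
  set δ := Real.log lam - μ with hδ
  set φ : ℝ → ℝ := fun t => Real.exp (-t) *
    ((Real.log κ - 1 / 2 * Real.log (τ / (2 * π)) + τ / 2 * δ ^ 2) + (1 + τ * δ / κ) * Real.log t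
      + (τ / (2 * κ ^ 2)) * Real.log t ^ 2 - t) with hφ
  have key : ∀ x ∈ Set.Ioi (0:ℝ), weibullPdf lam κ x *
      Real.log (weibullPdf lam κ x / lognormalPdf μ τ x) =
      lam⁻¹ * (fun u : ℝ => (|κ| * u ^ (κ - 1)) • φ (u ^ κ)) (lam⁻¹ * x) := by
    intro x hx
    have hx : 0 < x := hx
    have hu : lam⁻¹ * x = x / lam := by field_simp
    have hup : 0 < x / lam := by positivity
    have hq : 0 < τ / (2 * π) := by positivity
    have hlx : Real.log x = Real.log lam + Real.log (x / lam) := by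
      rw [Real.log_div hx.ne' hlam.ne']; ring
    simp only [hφ, hu, smul_eq_mul, abs_of_pos hκ, weibullPdf, lognormalPdf]
    have hr : 0 < (x / lam) ^ (κ - 1) := by positivity
    rw [Real.log_div (by positivity) (by positivity), Real.log_mul (by positivity) (by positivity),
      Real.log_mul (by positivity) (by positivity), Real.log_mul (by positivity) (by positivity),
      Real.log_mul (by positivity) (by positivity), Real.log_exp, Real.log_exp,
      Real.log_rpow hup, Real.log_rpow hup, Real.log_sqrt hq.le, Real.log_div hκ.ne' hlam.ne',
      one_div, Real.log_inv, hlx]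
    have : μ = Real.log lam - δ := by rw [hδ]; ring
    rw [this]
    field_simp
    ring
  rw [klDivPos, setIntegral_congr_fun measurableSet_Ioi key, integral_const_mul,
    integral_comp_mul_left_Ioi (fun u : ℝ => (|κ| * u ^ (κ - 1)) • φ (u ^ κ)) 0 (inv_pos.2 hlam), mul_zero, integral_comp_rpow_Ioi φ hκ.ne',
    hφ, int_quad, smul_eq_mul, inv_inv, ← mul_assoc, inv_mul_cancel₀ hlam.ne', one_mul]
  field_simp
  ring

/-- for every `λ, κ > 0`, the infimum over `(μ, τ) ∈ ℝ × (0, ∞)` of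
`D_KL(Weibull(λ, κ) ‖ lognormal(μ, τ))` equals
`(1/2) log(2π) + log π − γ − (1/2) log 6 − 1/2` (hence does not depend on `(λ, κ)`),
and it is attained at `μ = log λ − γ/κ`, `τ = 6κ²/π²`. -/
theorem inf_kl_weibull_lognormal (lam κ : ℝ) (hlam : 0 < lam) (hκ : 0 < κ) :
    sInf {d : ℝ | ∃ μ τ : ℝ, 0 < τ ∧
          d = klDivPos (weibullPdf lam κ) (lognormalPdf μ τ)} =
        (1 / 2) * Real.log (2 * Real.pi) + Real.log Real.pi -
          Real.eulerMascheroniConstant - (1 / 2) * Real.log 6 - 1 / 2 ∧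
      klDivPos (weibullPdf lam κ)
          (lognormalPdf (Real.log lam - Real.eulerMascheroniConstant / κ)
            (6 * κ ^ 2 / Real.pi ^ 2)) =
        (1 / 2) * Real.log (2 * Real.pi) + Real.log Real.pi -
          Real.eulerMascheroniConstant - (1 / 2) * Real.log 6 - 1 / 2 := by
  set K : ℝ := (1 / 2) * Real.log (2 * Real.pi) + Real.log Real.pi -
          Real.eulerMascheroniConstant - (1 / 2) * Real.log 6 - 1 / 2 with hK
  have hpi := pi_pos
  have hform : ∀ μ τ : ℝ, 0 < τ → klDivPos (weibullPdf lam κ) (lognormalPdf μ τ) =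
      K + τ / 2 * (Real.log lam - μ - eulerMascheroniConstant / κ) ^ 2 +
      1 / 2 * (τ * π ^ 2 / (6 * κ ^ 2) - 1 - Real.log (τ * π ^ 2 / (6 * κ ^ 2))) := by
    intro μ τ hτ
    rw [kl_formula lam κ μ τ hlam hκ hτ, hK,
      Real.log_div (x := τ * π ^ 2) (by positivity) (by positivity),
      Real.log_div (x := τ) (by positivity) (by positivity),
      Real.log_mul (x := τ) (by positivity) (by positivity),
      Real.log_mul (x := 6) (by positivity) (by positivity), Real.log_pow, Real.log_pow]
    push_cast
    field_simp
    ring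
  have hmin : klDivPos (weibullPdf lam κ)
      (lognormalPdf (Real.log lam - Real.eulerMascheroniConstant / κ)
        (6 * κ ^ 2 / Real.pi ^ 2)) = K := by
    rw [hform _ _ (by positivity)]
    have : 6 * κ ^ 2 / π ^ 2 * π ^ 2 / (6 * κ ^ 2) = 1 := by field_simp
    rw [this]
    simp
  refine ⟨?_, hmin⟩
  apply IsLeast.csInf_eq
  refine ⟨⟨_, _, by positivity, hmin.symm⟩, ?_⟩
  rintro d ⟨μ, τ, hτ, rfl⟩
  rw [hform μ τ hτ]
  have h1 := Real.log_le_sub_one_of_pos (show 0 < τ * π ^ 2 / (6 * κ ^ 2) by positivity)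
  have h2 : 0 ≤ τ / 2 * (Real.log lam - μ - eulerMascheroniConstant / κ) ^ 2 := by positivity
  linarith
end
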